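/- Mixing covariance bound (Lemma on time-dependent second moments). Suppose (𝒦, ν, c₁, ρ) satisfies the U_d-geometric-ergodicity bound for d = 1 and for d = 2, and set K₂ := ∫ (1+‖w'‖²) dν(w'). Let L > 0 and let h : 𝒲 → ℝ^{d_ξ} be measurable with ‖h(w')‖ ≤ L(1+‖w'‖) for all w' ∈ 𝒲 and ∫ h dν = 0. Then for all integers u ≥ 0 and v ≥ 0 and every w ∈ 𝒲: | ∫ ⟨ ∫ h(w₁) d(𝒦^v(w₂))(w₁), h(w₂) ⟩ d(𝒦^u(w))(w₂) | ≤ 2L²c₁·ρ^v·( c₁(1+‖w‖²) + K₂ ). (In the paper this is the bound |E[H(W_{l₁}, ξ*)ᵀ H(W_{l₂}, ξ*) | W_m]| ≤ 2L²c₁ ρ^{l₁−l₂} (c₁(1+‖W_m‖²) + K_{d_U}) for l₁ ≥ l₂ ≥ m, with u = l₂ − m and v = l₁ − l₂, using that H(·, ξ*) has mean zero under ν.) -/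

import Mathlib

open MeasureTheory ProbabilityTheory Filter
open scoped RealInnerProductSpace

noncomputable section

/-- Euclidean state space. -/
abbrev Wsp (dW : ℕ) : Type := EuclideanSpace ℝ (Fin dW)

/-- `t`-step iterate of a Markov kernel. -/
noncomputable def kiter {α : Type*} [MeasurableSpace α] (K : Kernel α α) : ℕ → Kernel α α :=
  fun t => Nat.rec (motive := fun _ => Kernel α α) Kernel.id (fun _ ih => ih.comp K) t

instance kiter_isMarkovKernel {α : Type*} [MeasurableSpace α] (K : Kernel α α)
    [IsMarkovKernel K] (t : ℕ) : IsMarkovKernel (kiter K t) := by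
  induction t with
  | zero => exact inferInstanceAs (IsMarkovKernel (Kernel.id))
  | succ n ih => exact inferInstanceAs (IsMarkovKernel ((kiter K n).comp K))

/-- U_d geometric ergodicity bound. -/
def UdBound {dW : ℕ} (K : Kernel (Wsp dW) (Wsp dW)) [IsMarkovKernel K]
    (ν : Measure (Wsp dW)) [IsProbabilityMeasure ν] (c₁ ρ d : ℝ) : Prop :=
  Integrable (fun w' => (1 : ℝ) + ‖w'‖ ^ d) ν ∧
  ∀ (t : ℕ) (w : Wsp dW) (f : Wsp dW → ℝ), Measurable f →
    (∀ w', |f w'| ≤ 1 + ‖w'‖ ^ d) →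
      (∫ w', |f w'|
          ∂((((kiter K t) w).toSignedMeasure - ν.toSignedMeasure).totalVariation))
        ≤ c₁ * ρ ^ t * (1 + ‖w‖ ^ d)


/-- A nonnegative function whose truncations have bounded integrals is integrable. -/
theorem integrable_of_integral_min_le {α : Type*} [MeasurableSpace α] {m : Measure α}
    [IsFiniteMeasure m] {g : α → ℝ} (hg : Measurable g) (hg0 : ∀ x, 0 ≤ g x) {C : ℝ}
    (hC : ∀ n : ℕ, ∫ x, min (g x) n ∂m ≤ C) : Integrable g m := by
  have hmin0 (n : ℕ) (x : α) : 0 ≤ min (g x) n := le_min (hg0 x) n.cast_nonneg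
  have hbound (n : ℕ) : ∫⁻ x, ENNReal.ofReal (min (g x) n) ∂m ≤ ENNReal.ofReal C := by
    have hint : Integrable (fun x => min (g x) (n : ℝ)) m := by
      refine Integrable.of_bound (hg.min measurable_const).aestronglyMeasurable (n : ℝ)
        (Eventually.of_forall fun x => ?_)
      rw [Real.norm_of_nonneg (hmin0 n x)]
      exact min_le_right _ _
    rw [← ofReal_integral_eq_lintegral_ofReal hint (Eventually.of_forall (hmin0 n))]
    exact ENNReal.ofReal_le_ofReal (hC n)
  refine ⟨hg.aestronglyMeasurable, ?_⟩
  rw [hasFiniteIntegral_iff_ofReal (Eventually.of_forall hg0)]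
  have hliminf (x : α) :
      liminf (fun n : ℕ => ENNReal.ofReal (min (g x) n)) atTop = ENNReal.ofReal (g x) := by
    refine Tendsto.liminf_eq (tendsto_const_nhds.congr' ?_)
    obtain ⟨N, hN⟩ := exists_nat_ge (g x)
    filter_upwards [eventually_ge_atTop N] with n hn
    rw [min_eq_left (hN.trans (Nat.cast_le.2 hn))]
  calc ∫⁻ x, ENNReal.ofReal (g x) ∂m
      = ∫⁻ x, liminf (fun n : ℕ => ENNReal.ofReal (min (g x) n)) atTop ∂m := by
        simp_rw [hliminf]
    _ ≤ liminf (fun n : ℕ => ∫⁻ x, ENNReal.ofReal (min (g x) n) ∂m) atTop :=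
        lintegral_liminf_le fun n => (hg.min measurable_const).ennreal_ofReal
    _ ≤ liminf (fun _ : ℕ => ENNReal.ofReal C) atTop :=
        liminf_le_liminf (Eventually.of_forall hbound)
    _ < ⊤ := by simp

section TotalVariation

variable {α : Type*} [MeasurableSpace α] (μ ν : Measure α) [IsFiniteMeasure μ] [IsFiniteMeasure ν]

/-- The Jordan decomposition of a difference of finite measures, without subtraction. -/
theorem add_negPart_eq_add_posPart :
    μ + (μ.toSignedMeasure - ν.toSignedMeasure).toJordanDecomposition.negPart =
      ν + (μ.toSignedMeasure - ν.toSignedMeasure).toJordanDecomposition.posPart := by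
  have hs := SignedMeasure.toSignedMeasure_toJordanDecomposition
    (μ.toSignedMeasure - ν.toSignedMeasure)
  rw [JordanDecomposition.toSignedMeasure, sub_eq_sub_iff_add_eq_add] at hs
  rw [← Measure.toSignedMeasure_eq_toSignedMeasure_iff, Measure.toSignedMeasure_add,
    Measure.toSignedMeasure_add, ← hs, add_comm]

variable {μ ν} {E : Type*} [NormedAddCommGroup E] {f : α → E}

theorem integrable_of_integrable_totalVariation (hν : Integrable f ν)
    (htv : Integrable f (μ.toSignedMeasure - ν.toSignedMeasure).totalVariation) :
    Integrable f μ := by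
  rw [SignedMeasure.totalVariation, integrable_add_measure] at htv
  have hsum := hν.add_measure htv.1
  rw [← add_negPart_eq_add_posPart, integrable_add_measure] at hsum
  exact hsum.1

theorem norm_integral_sub_le_integral_totalVariation [NormedSpace ℝ E] (hν : Integrable f ν)
    (htv : Integrable f (μ.toSignedMeasure - ν.toSignedMeasure).totalVariation) :
    ‖∫ x, f x ∂μ - ∫ x, f x ∂ν‖ ≤
      ∫ x, ‖f x‖ ∂(μ.toSignedMeasure - ν.toSignedMeasure).totalVariation := by
  have hμ := integrable_of_integrable_totalVariation hν htv
  rw [SignedMeasure.totalVariation, integrable_add_measure] at htv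
  have hsum := congrArg (fun m => ∫ x, f x ∂m) (add_negPart_eq_add_posPart μ ν)
  simp only [integral_add_measure hμ htv.2, integral_add_measure hν htv.1] at hsum
  rw [SignedMeasure.totalVariation, integral_add_measure htv.1.norm htv.2.norm,
    sub_eq_sub_iff_add_eq_add.2 (hsum.trans (add_comm _ _))]
  exact (norm_sub_le _ _).trans
    (add_le_add (norm_integral_le_integral_norm _) (norm_integral_le_integral_norm _))

end TotalVariation

section UdBound

variable {dW : ℕ} {K : Kernel (Wsp dW) (Wsp dW)} [IsMarkovKernel K] {ν : Measure (Wsp dW)}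
  [IsProbabilityMeasure ν] {c₁ ρ d : ℝ}

theorem UdBound.integrable_totalVariation (hU : UdBound K ν c₁ ρ d) (t : ℕ) (w : Wsp dW) :
    Integrable (fun w' => (1 : ℝ) + ‖w'‖ ^ d)
      (((kiter K t) w).toSignedMeasure - ν.toSignedMeasure).totalVariation := by
  have hm : Measurable fun w' : Wsp dW => (1 : ℝ) + ‖w'‖ ^ d := by fun_prop
  have h0 (w' : Wsp dW) : (0 : ℝ) ≤ 1 + ‖w'‖ ^ d := by positivity
  refine integrable_of_integral_min_le hm h0 (C := c₁ * ρ ^ t * (1 + ‖w‖ ^ d)) fun n => ?_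
  have habs (w' : Wsp dW) : |min (1 + ‖w'‖ ^ d) (n : ℝ)| = min (1 + ‖w'‖ ^ d) (n : ℝ) :=
    abs_of_nonneg (le_min (h0 w') n.cast_nonneg)
  have := hU.2 t w (fun w' => min (1 + ‖w'‖ ^ d) (n : ℝ)) (hm.min measurable_const)
    fun w' => (habs w').le.trans (min_le_left _ _)
  simpa only [habs] using this

theorem UdBound.integrable_kiter (hU : UdBound K ν c₁ ρ d) (t : ℕ) (w : Wsp dW) :
    Integrable (fun w' => (1 : ℝ) + ‖w'‖ ^ d) ((kiter K t) w) :=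
  integrable_of_integrable_totalVariation hU.1 (hU.integrable_totalVariation t w)

/-- Geometric convergence of the expectations of a vector-valued observable. -/
theorem UdBound.norm_integral_kiter_sub_le (hU : UdBound K ν c₁ ρ d) {E : Type*}
    [NormedAddCommGroup E] [NormedSpace ℝ E] [MeasurableSpace E] [BorelSpace E]
    [SecondCountableTopology E] {L : ℝ} (hL : 0 < L) {h : Wsp dW → E} (hmeas : Measurable h)
    (hgrow : ∀ w', ‖h w'‖ ≤ L * (1 + ‖w'‖ ^ d)) (t : ℕ) (w : Wsp dW) :
    ‖∫ w', h w' ∂((kiter K t) w) - ∫ w', h w' ∂ν‖ ≤ L * (c₁ * ρ ^ t * (1 + ‖w‖ ^ d)) := by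
  have hint {m : Measure (Wsp dW)} (hm : Integrable (fun w' => (1 : ℝ) + ‖w'‖ ^ d) m) :
      Integrable h m :=
    (hm.const_mul L).mono' hmeas.aestronglyMeasurable (Eventually.of_forall hgrow)
  refine (norm_integral_sub_le_integral_totalVariation (hint hU.1)
    (hint (hU.integrable_totalVariation t w))).trans ?_
  have habs (w' : Wsp dW) : |L⁻¹ * ‖h w'‖| = L⁻¹ * ‖h w'‖ := abs_of_nonneg (by positivity)
  have := hU.2 t w (fun w' => L⁻¹ * ‖h w'‖) (hmeas.norm.const_mul _) fun w' => by
    rw [habs, inv_mul_le_iff₀ hL]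
    exact hgrow w'
  simp only [habs] at this
  rwa [integral_const_mul, inv_mul_le_iff₀ hL] at this

end UdBound

/-- Mixing covariance bound. -/
theorem mixing_covariance_bound
    {dW dX : ℕ}
    (K : Kernel (Wsp dW) (Wsp dW)) [IsMarkovKernel K]
    (ν : Measure (Wsp dW)) [IsProbabilityMeasure ν]
    (hstat : ν.bind (⇑K) = ν)
    (c₁ ρ : ℝ) (hc₁ : 0 < c₁) (hρ₀ : 0 ≤ ρ) (hρ₁ : ρ < 1)
    (hU1 : UdBound K ν c₁ ρ 1) (hU2 : UdBound K ν c₁ ρ 2)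
    (L : ℝ) (hL : 0 < L)
    (h : Wsp dW → EuclideanSpace ℝ (Fin dX))
    (hmeas : Measurable h)
    (hgrow : ∀ w', ‖h w'‖ ≤ L * (1 + ‖w'‖))
    (hmean : (∫ w', h w' ∂ν) = 0) :
    ∀ (u v : ℕ) (w : Wsp dW),
      |∫ w₂, ⟪(∫ w₁, h w₁ ∂((kiter K v) w₂)), h w₂⟫ ∂((kiter K u) w)|
        ≤ 2 * L ^ 2 * c₁ * ρ ^ v *
            (c₁ * (1 + ‖w‖ ^ 2) + ∫ w', (1 + ‖w'‖ ^ 2) ∂ν) := by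
  intro u v w
  have hdrift (w₂ : Wsp dW) :
      ‖∫ w₁, h w₁ ∂((kiter K v) w₂)‖ ≤ L * (c₁ * ρ ^ v * (1 + ‖w₂‖)) := by
    have := hU1.norm_integral_kiter_sub_le hL hmeas (by simpa using hgrow) v w₂
    simpa [hmean] using this
  have hpoint (w₂ : Wsp dW) : ‖⟪(∫ w₁, h w₁ ∂((kiter K v) w₂)), h w₂⟫‖ ≤
      2 * L ^ 2 * c₁ * ρ ^ v * (1 + ‖w₂‖ ^ 2) := by
    calc ‖⟪(∫ w₁, h w₁ ∂((kiter K v) w₂)), h w₂⟫‖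
        ≤ L * (c₁ * ρ ^ v * (1 + ‖w₂‖)) * (L * (1 + ‖w₂‖)) :=
          (norm_inner_le_norm _ _).trans
            (mul_le_mul (hdrift w₂) (hgrow w₂) (norm_nonneg _) (by positivity))
      _ = L ^ 2 * c₁ * ρ ^ v * (1 + ‖w₂‖) ^ 2 := by ring
      _ ≤ L ^ 2 * c₁ * ρ ^ v * (2 * (1 + ‖w₂‖ ^ 2)) := by
          gcongr
          nlinarith [sq_nonneg (1 - ‖w₂‖)]
      _ = 2 * L ^ 2 * c₁ * ρ ^ v * (1 + ‖w₂‖ ^ 2) := by ring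
  have hint := hU2.integrable_kiter u w
  have hmoment : ∫ w', (1 + ‖w'‖ ^ 2) ∂((kiter K u) w) ≤
      c₁ * (1 + ‖w‖ ^ 2) + ∫ w', (1 + ‖w'‖ ^ 2) ∂ν := by
    have hdiff := hU2.norm_integral_kiter_sub_le one_pos
      (h := fun w' : Wsp dW => (1 : ℝ) + ‖w'‖ ^ (2 : ℝ)) (by fun_prop)
      (fun w' => by rw [Real.norm_of_nonneg (by positivity), one_mul]) u w
    simp only [Real.rpow_two, one_mul] at hdiff
    have hρu : c₁ * ρ ^ u * (1 + ‖w‖ ^ 2) ≤ c₁ * (1 + ‖w‖ ^ 2) := by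
      gcongr
      exact mul_le_of_le_one_right hc₁.le (pow_le_one₀ hρ₀ hρ₁.le)
    linarith [(le_abs_self _).trans hdiff]
  simp only [Real.rpow_two] at hint
  rw [← Real.norm_eq_abs]
  refine (norm_integral_le_of_norm_le (hint.const_mul (2 * L ^ 2 * c₁ * ρ ^ v))
    (Eventually.of_forall hpoint)).trans ?_
  rw [integral_const_mul]
  gcongr

end
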